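/- Let H be a separable real Hilbert space with Hilbert basis (e_i)_{i∈ι} indexed by a countable type ι, and let (λ_i)_{i∈ι} be positive reals. Fix θ ∈ [0,1] and t > 0. Then for every x ∈ H the family (λ_i^(−θ) · (1 − exp(−λ_i t)) · ⟨x, e_i⟩ · e_i)_{i∈ι} is summable in H and the norm of its sum is at most t^θ · ‖x‖. -/

import Mathlib

open scoped RealInnerProductSpace

theorem scalar_aux (l θ t : ℝ) (hl : 0 < l) (hθ0 : 0 ≤ θ) (hθ1 : θ ≤ 1) (ht : 0 < t) :
    |l ^ (-θ) * (1 - Real.exp (-(l * t)))| ≤ t ^ θ := by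
  have hs : 0 < l * t := mul_pos hl ht
  have h0 : 0 ≤ 1 - Real.exp (-(l * t)) := by
    have := Real.exp_le_one_iff.2 (by linarith : -(l * t) ≤ 0)
    linarith
  have h1 : 1 - Real.exp (-(l * t)) ≤ (l * t) ^ θ := by
    rcases le_total (l * t) 1 with h | h
    · have h2 := Real.add_one_le_exp (-(l * t))
      have h3 := Real.rpow_le_rpow_of_exponent_ge hs h hθ1
      rw [Real.rpow_one] at h3
      linarith
    · have h2 := Real.exp_pos (-(l * t))
      have h3 := Real.one_le_rpow h hθ0
      linarith
  have hp : 0 < l ^ θ := Real.rpow_pos_of_pos hl θ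
  rw [Real.mul_rpow hl.le ht.le] at h1
  rw [Real.rpow_neg hl.le, abs_of_nonneg (mul_nonneg (inv_nonneg.2 hp.le) h0),
    inv_mul_le_iff₀ hp]
  exact h1

/-- Operator bound `‖(-A)^(-θ) (I - e^{At}) x‖ ≤ t^θ ‖x‖` for a diagonal
negative-definite generator, via the eigenbasis expansion. -/
theorem diagonal_holder_bound
    {H : Type*} [NormedAddCommGroup H] [InnerProductSpace ℝ H]
    {ι : Type*} [Countable ι]
    (e : HilbertBasis ι ℝ H) (lam : ι → ℝ) (hlam : ∀ i, 0 < lam i)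
    (θ : ℝ) (hθ0 : 0 ≤ θ) (hθ1 : θ ≤ 1) (t : ℝ) (ht : 0 < t) (x : H) :
    Summable (fun i : ι => (lam i ^ (-θ) * (1 - Real.exp (-(lam i * t))) * ⟪x, e i⟫) • (e i : H))
    ∧ ‖∑' i : ι, (lam i ^ (-θ) * (1 - Real.exp (-(lam i * t))) * ⟪x, e i⟫) • (e i : H)‖
      ≤ t ^ θ * ‖x‖ := by
  have hT : 0 ≤ t ^ θ := Real.rpow_nonneg ht.le θ
  have h2 : 0 < (2 : ENNReal).toReal := by norm_num
  set g : ι → ℝ := fun i => lam i ^ (-θ) * (1 - Real.exp (-(lam i * t))) * ⟪x, e i⟫ with hg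
  let f : lp (fun _ : ι => ℝ) 2 := t ^ θ • e.repr x
  have hb : ∀ i, ‖g i‖ ≤ ‖f i‖ := by
    intro i
    have hf : f i = t ^ θ * ⟪x, e i⟫ := by
      simp [f, e.repr_apply_apply, real_inner_comm]
    rw [hf, hg, norm_mul, norm_mul (t ^ θ), Real.norm_of_nonneg hT]
    exact mul_le_mul_of_nonneg_right (scalar_aux _ _ _ (hlam i) hθ0 hθ1 ht) (norm_nonneg _)
  have hb' : ∀ i, ‖g i‖ ^ (2 : ENNReal).toReal ≤ ‖f i‖ ^ (2 : ENNReal).toReal := fun i =>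
    Real.rpow_le_rpow (norm_nonneg _) (hb i) h2.le
  have hfs := (lp.memℓp f).summable h2
  have hm : Memℓp g 2 := memℓp_gen
    (Summable.of_nonneg_of_le (fun i => Real.rpow_nonneg (norm_nonneg _) _) hb' hfs)
  let G : lp (fun _ : ι => ℝ) 2 := ⟨g, hm⟩
  have hs := e.hasSum_repr_symm G
  have hs' : HasSum (fun i => g i • (e i : H)) (e.repr.symm G) := hs
  refine ⟨hs'.summable, ?_⟩
  rw [hs'.tsum_eq, LinearIsometryEquiv.norm_map]
  have hfn : ‖f‖ = t ^ θ * ‖x‖ := by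
    simp only [f]
    rw [norm_smul, LinearIsometryEquiv.norm_map, Real.norm_of_nonneg hT]
  rw [← hfn]
  refine lp.norm_le_of_tsum_le h2 (norm_nonneg _) ?_
  rw [lp.norm_rpow_eq_tsum h2 f]
  exact (hm.summable h2).tsum_le_tsum hb' hfs
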